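/- For N = 3, the characteristic value satisfies l_β ~ 1/(2 log(2/(π−β))) as β → π⁻; in particular l_β → 0 and hence (N + 2l_β − 2)/N → 1/3 as β → π⁻. -/

import Mathlib

open Real Filter Topology

/-- The characteristic value `l_β` of the spherical cap `C_β ⊆ S²`: the smallest
`l > 0` such that `l(l+1)` is a Dirichlet eigenvalue of the Laplace–Beltrami
operator on `C_β`. By separation of variables and axial symmetry of the first
eigenfunction, it is the smallest `l > 0` such that the Legendre-type ODE
`(sin θ · Θ')' = -l(l+1) sin θ · Θ` on `(0, β)` has a nontrivial solution that is
continuous up to the pole and vanishes at `θ = β`. -/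
noncomputable def capCharValue (β : ℝ) : ℝ :=
  sInf {l : ℝ | 0 < l ∧ ∃ Θ : ℝ → ℝ,
    ContinuousOn Θ (Set.Icc 0 β) ∧
    (∀ θ ∈ Set.Ioo (0 : ℝ) β, DifferentiableAt ℝ Θ θ) ∧
    (∀ θ ∈ Set.Ioo (0 : ℝ) β,
      deriv (fun t => Real.sin t * deriv Θ t) θ = -(l * (l + 1)) * Real.sin θ * Θ θ) ∧
    Θ β = 0 ∧ ∃ θ ∈ Set.Ioo (0 : ℝ) β, Θ θ ≠ 0}

/-- A power series whose coefficients are `O(1/n)` can be differentiated termwise on `(-1, 1)`. -/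
theorem hasDerivAt_tsum_mul_pow {a : ℕ → ℝ} {B : ℝ} (h : ∀ n : ℕ, |n * a n| ≤ B) {x : ℝ}
    (hx : |x| < 1) :
    HasDerivAt (fun y => ∑' n, a n * y ^ n) (∑' n : ℕ, a n * (n * x ^ (n - 1))) x := by
  obtain ⟨r, hxr, hr1⟩ := exists_between hx
  have hr0 : 0 ≤ r := (abs_nonneg x).trans hxr.le
  have hsum : Summable (fun n : ℕ => B * r ^ (n - 1)) := by
    refine Summable.mul_left _ ?_
    rw [← summable_nat_add_iff 1]
    simpa using summable_geometric_of_lt_one hr0 hr1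
  refine hasDerivAt_tsum_of_isPreconnected (t := Metric.ball (0 : ℝ) r) (y₀ := 0) hsum
    Metric.isOpen_ball (convex_ball (0 : ℝ) r).isPreconnected
    (fun n y _ => (hasDerivAt_pow n y).const_mul (a n)) ?_ ?_ ?_ ?_
  · intro n y hy
    have hy' : |y| ≤ r := by simpa using (mem_ball_zero_iff.1 hy).le
    have : ‖a n * (n * y ^ (n - 1))‖ = |n * a n| * |y| ^ (n - 1) := by
      rw [Real.norm_eq_abs, ← abs_pow, ← abs_mul]
      ring_nf
    rw [this]
    have := h n
    have := abs_nonneg ((n : ℝ) * a n)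
    gcongr
    linarith
  · exact Metric.mem_ball_self (lt_of_le_of_lt (abs_nonneg x) hxr)
  · refine summable_of_ne_finset_zero (s := {0}) ?_
    intro n hn
    simp at hn
    simp [hn]
  · simpa using hxr

/-- Taylor coefficients at `x = 0` of the Legendre function with `l (l + 1) = μ`, in the variable
`x = (1 - cos θ) / 2`. -/
noncomputable def legendreCoeff (μ : ℝ) : ℕ → ℝ
  | 0 => 1
  | n + 1 => legendreCoeff μ n * (n * (n + 1) - μ) / (n + 1) ^ 2

theorem legendreCoeff_succ (μ : ℝ) (n : ℕ) :
    legendreCoeff μ (n + 1) = legendreCoeff μ n * (n * (n + 1) - μ) / (n + 1) ^ 2 := rfl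

theorem succ_mul_legendreCoeff_succ (μ : ℝ) (n : ℕ) :
    ((n : ℝ) + 1) * legendreCoeff μ (n + 1)
      = n * legendreCoeff μ n - μ * legendreCoeff μ n / (n + 1) := by
  rw [legendreCoeff_succ]
  field_simp

theorem legendreCoeff_bounds {μ : ℝ} (h0 : 0 ≤ μ) (h1 : μ ≤ 1) (n : ℕ) :
    -μ ≤ ((n : ℝ) + 1) * legendreCoeff μ (n + 1) ∧
      ((n : ℝ) + 1) * legendreCoeff μ (n + 1) ≤ -(μ * (1 - μ * (1 - 1 / (n + 1)))) := by
  induction n with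
  | zero => simp [legendreCoeff]
  | succ n ih =>
    obtain ⟨ih1, ih2⟩ := ih
    rw [succ_mul_legendreCoeff_succ]
    push_cast
    set d := ((n : ℝ) + 1) * legendreCoeff μ (n + 1) with hd
    have hk : legendreCoeff μ (n + 1) = d / (n + 1) := by rw [hd]; field_simp
    have hn : (0 : ℝ) ≤ n := n.cast_nonneg
    have hdn : d ≤ 0 := by
      have : (0 : ℝ) ≤ 1 - 1 / (n + 1) ∧ 1 - 1 / ((n : ℝ) + 1) ≤ 1 := by
        have h2 : 1 / ((n : ℝ) + 1) ≤ 1 := by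
          rw [div_le_one (by positivity)]; linarith
        have h3 : 0 ≤ 1 / ((n : ℝ) + 1) := by positivity
        constructor <;> linarith
      have h4 : μ * (1 - 1 / ((n : ℝ) + 1)) ≤ 1 := mul_le_one₀ h1 this.1 this.2
      have : 0 ≤ μ * (1 - μ * (1 - 1 / ((n : ℝ) + 1))) := mul_nonneg h0 (by linarith)
      linarith
    rw [hk]
    have e : μ * (d / (n + 1)) / ((n : ℝ) + 1 + 1) = μ * d * (1 / (n + 1) - 1 / (n + 1 + 1)) := by
      field_simp
      ring
    have hpos : 0 ≤ 1 / ((n : ℝ) + 1) - 1 / (n + 1 + 1) := by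
      rw [sub_nonneg]
      gcongr
      linarith
    rw [e]
    constructor
    · have : μ * d * (1 / ((n : ℝ) + 1) - 1 / (n + 1 + 1)) ≤ 0 :=
        mul_nonpos_of_nonpos_of_nonneg (mul_nonpos_of_nonneg_of_nonpos h0 hdn) hpos
      linarith
    · have : μ * (-μ) * (1 / ((n : ℝ) + 1) - 1 / (n + 1 + 1))
          ≤ μ * d * (1 / ((n : ℝ) + 1) - 1 / (n + 1 + 1)) := by gcongr
      linarith

theorem abs_nat_mul_legendreCoeff_le {μ : ℝ} (h0 : 0 ≤ μ) (h1 : μ ≤ 1) (n : ℕ) :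
    |n * legendreCoeff μ n| ≤ 1 := by
  cases n with
  | zero => simp
  | succ n =>
    obtain ⟨h2, h3⟩ := legendreCoeff_bounds h0 h1 n
    have hn : (0 : ℝ) ≤ n := n.cast_nonneg
    have h5 : 1 / ((n : ℝ) + 1) ≤ 1 := by
      rw [div_le_one (by positivity)]; linarith
    have h6 : 0 ≤ 1 / ((n : ℝ) + 1) := by positivity
    have h4 : μ * (1 - 1 / ((n : ℝ) + 1)) ≤ 1 := mul_le_one₀ h1 (by linarith) (by linarith)
    have : 0 ≤ μ * (1 - μ * (1 - 1 / ((n : ℝ) + 1))) := mul_nonneg h0 (by linarith)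
    push_cast
    rw [abs_le]
    constructor <;> linarith

theorem abs_legendreCoeff_le {μ : ℝ} (h0 : 0 ≤ μ) (h1 : μ ≤ 1) (n : ℕ) :
    |legendreCoeff μ n| ≤ 1 := by
  cases n with
  | zero => simp [legendreCoeff]
  | succ n =>
    have h := abs_nat_mul_legendreCoeff_le h0 h1 (n + 1)
    rw [abs_mul, abs_of_nonneg (Nat.cast_nonneg _)] at h
    push_cast at h
    nlinarith [abs_nonneg (legendreCoeff μ (n + 1)), (Nat.cast_nonneg n : (0 : ℝ) ≤ n)]

theorem continuous_legendreCoeff (n : ℕ) : Continuous fun μ => legendreCoeff μ n := by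
  induction n with
  | zero => exact continuous_const
  | succ n ih =>
    simp only [legendreCoeff_succ]
    fun_prop

theorem summable_mul_pow_of_abs_le {a : ℕ → ℝ} {B : ℝ} (h : ∀ n, |a n| ≤ B) {x : ℝ}
    (hx : |x| < 1) : Summable fun n => a n * x ^ n := by
  refine Summable.of_norm_bounded (g := fun n => B * |x| ^ n)
    ((summable_geometric_of_lt_one (abs_nonneg x) hx).mul_left B) fun n => ?_
  rw [norm_mul, norm_pow, Real.norm_eq_abs, Real.norm_eq_abs]
  gcongr
  exact h n

/-- The Legendre function regular at the pole, as a function of `x = (1 - cos θ) / 2`. -/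
noncomputable def legendreFun (μ x : ℝ) : ℝ := ∑' n, legendreCoeff μ n * x ^ n

/-- Taylor coefficients of `x (1 - x) u'`, where `u = legendreFun μ`. -/
noncomputable def legendreFluxCoeff (μ : ℝ) : ℕ → ℝ
  | 0 => 0
  | n + 1 => -μ * legendreCoeff μ n / (n + 1)

/-- The flux `x (1 - x) u'`, where `u = legendreFun μ`. -/
noncomputable def legendreFlux (μ x : ℝ) : ℝ := ∑' n, legendreFluxCoeff μ n * x ^ n

theorem hasDerivAt_legendreFlux {μ : ℝ} (h0 : 0 ≤ μ) (h1 : μ ≤ 1) {x : ℝ} (hx : |x| < 1) :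
    HasDerivAt (legendreFlux μ) (-μ * legendreFun μ x) x := by
  have hb : ∀ n : ℕ, |n * legendreFluxCoeff μ n| ≤ 1 := by
    intro n
    cases n with
    | zero => simp
    | succ n =>
      have : ((n + 1 : ℕ) : ℝ) * legendreFluxCoeff μ (n + 1) = -μ * legendreCoeff μ n := by
        simp only [legendreFluxCoeff]
        push_cast
        field_simp
      rw [this, abs_mul, abs_neg, abs_of_nonneg h0]
      exact mul_le_one₀ h1 (abs_nonneg _) (abs_legendreCoeff_le h0 h1 n)
  refine (hasDerivAt_tsum_mul_pow hb hx).congr_deriv ?_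
  have e : ∀ n : ℕ, legendreFluxCoeff μ (n + 1) * (((n + 1 : ℕ) : ℝ) * x ^ (n + 1 - 1))
      = -μ * (legendreCoeff μ n * x ^ n) := by
    intro n
    simp only [legendreFluxCoeff, Nat.add_sub_cancel]
    push_cast
    field_simp
  have hs : Summable fun n : ℕ => legendreFluxCoeff μ n * (n * x ^ (n - 1)) := by
    rw [← summable_nat_add_iff 1]
    simp only [e]
    exact (summable_mul_pow_of_abs_le (abs_legendreCoeff_le h0 h1) hx).mul_left _
  rw [hs.tsum_eq_zero_add]
  simp only [e, tsum_mul_left, legendreFun]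
  simp

theorem exists_hasDerivAt_legendreFun {μ : ℝ} (h0 : 0 ≤ μ) (h1 : μ ≤ 1) {x : ℝ} (hx : |x| < 1) :
    ∃ d, HasDerivAt (legendreFun μ) d x ∧ x * (1 - x) * d = legendreFlux μ x := by
  refine ⟨_, hasDerivAt_tsum_mul_pow (abs_nat_mul_legendreCoeff_le h0 h1) hx, ?_⟩
  have hS := summable_mul_pow_of_abs_le (abs_nat_mul_legendreCoeff_le h0 h1) hx
  have e1 : x * ∑' n : ℕ, legendreCoeff μ n * (n * x ^ (n - 1))
      = ∑' n : ℕ, n * legendreCoeff μ n * x ^ n := by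
    rw [← tsum_mul_left]
    congr 1
    ext n
    cases n with
    | zero => simp
    | succ n => rw [Nat.add_sub_cancel, pow_succ]; ring
  have e2 : ∀ n : ℕ, legendreFluxCoeff μ (n + 1) * x ^ (n + 1)
      = ((n + 1 : ℕ) : ℝ) * legendreCoeff μ (n + 1) * x ^ (n + 1)
        - x * (n * legendreCoeff μ n * x ^ n) := by
    intro n
    push_cast
    rw [succ_mul_legendreCoeff_succ]
    simp only [legendreFluxCoeff]
    ring
  have hS1 := (summable_nat_add_iff 1).2 hS
  have hsum : Summable fun n : ℕ => legendreFluxCoeff μ n * x ^ n := by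
    rw [← summable_nat_add_iff 1]
    simp only [e2]
    exact hS1.sub (hS.mul_left x)
  rw [legendreFlux, hsum.tsum_eq_zero_add]
  simp only [e2]
  rw [hS1.tsum_sub (hS.mul_left x), tsum_mul_left]
  have e3 := hS.tsum_eq_zero_add
  simp only [Nat.cast_zero, zero_mul, zero_add] at e3
  rw [← e3, ← e1]
  simp only [legendreFluxCoeff]
  ring

theorem continuousOn_legendreFun_param {x : ℝ} (hx : |x| < 1) :
    ContinuousOn (fun μ => legendreFun μ x) (Set.Icc 0 1) := by
  refine continuousOn_tsum (u := fun n => |x| ^ n)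
    (fun n => ((continuous_legendreCoeff n).mul continuous_const).continuousOn)
    (summable_geometric_of_lt_one (abs_nonneg x) hx) fun n μ hμ => ?_
  rw [norm_mul, norm_pow, Real.norm_eq_abs, Real.norm_eq_abs]
  exact mul_le_of_le_one_left (by positivity) (abs_legendreCoeff_le hμ.1 hμ.2 n)

theorem legendreFun_zero_left (x : ℝ) : legendreFun 0 x = 1 := by
  have h : ∀ n : ℕ, legendreCoeff 0 (n + 1) = 0 := by
    intro n
    induction n with
    | zero => simp [legendreCoeff]
    | succ n ih => rw [legendreCoeff_succ, ih]; simp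
  rw [legendreFun, tsum_eq_single 0]
  · simp [legendreCoeff]
  · intro n hn
    obtain ⟨k, rfl⟩ := Nat.exists_eq_succ_of_ne_zero hn
    simp [h]

theorem legendreFun_zero_right (μ : ℝ) : legendreFun μ 0 = 1 := by
  rw [legendreFun, tsum_eq_single 0]
  · simp [legendreCoeff]
  · intro n hn
    simp [hn]

theorem legendreFun_le {μ : ℝ} (h0 : 0 ≤ μ) (h1 : μ ≤ 1) {x : ℝ} (hx0 : 0 ≤ x) (hx1 : x < 1) :
    legendreFun μ x ≤ 1 + μ * (1 - μ) * Real.log (1 - x) := by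
  have hx : |x| < 1 := by rwa [abs_of_nonneg hx0]
  have hs := summable_mul_pow_of_abs_le (abs_legendreCoeff_le h0 h1) hx
  have hl := (Real.hasSum_pow_div_log_of_abs_lt_one hx).mul_left (-(μ * (1 - μ)))
  rw [legendreFun, hs.tsum_eq_zero_add]
  have : ∑' n : ℕ, legendreCoeff μ (n + 1) * x ^ (n + 1)
      ≤ -(μ * (1 - μ)) * -Real.log (1 - x) := by
    rw [← hl.tsum_eq]
    refine Summable.tsum_le_tsum (fun n => ?_) ((summable_nat_add_iff 1).2 hs) hl.summable
    have hb := (legendreCoeff_bounds h0 h1 n).2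
    have hn : (0 : ℝ) < n + 1 := by positivity
    have h6 : 0 ≤ 1 / ((n : ℝ) + 1) := by positivity
    have h7 : ((n : ℝ) + 1) * legendreCoeff μ (n + 1) ≤ -(μ * (1 - μ)) := by
      nlinarith [mul_nonneg (mul_nonneg h0 h0) h6]
    have h8 : legendreCoeff μ (n + 1) ≤ -(μ * (1 - μ)) / (n + 1) := by
      rw [le_div_iff₀ hn]; linarith
    calc legendreCoeff μ (n + 1) * x ^ (n + 1)
        ≤ -(μ * (1 - μ)) / (n + 1) * x ^ (n + 1) := by gcongr
      _ = _ := by ring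
  simp only [legendreCoeff, pow_zero, mul_one] at this ⊢
  linarith

theorem hasDerivAt_one_sub_cos_div_two (θ : ℝ) :
    HasDerivAt (fun t => (1 - Real.cos t) / 2) (Real.sin θ / 2) θ := by
  simpa using ((Real.hasDerivAt_cos θ).const_sub 1).div_const 2

theorem abs_one_sub_cos_div_two_lt_one {θ : ℝ} (h0 : 0 ≤ θ) (hπ : θ < π) :
    |(1 - Real.cos θ) / 2| < 1 := by
  have h1 : -1 < Real.cos θ := by
    rw [← Real.cos_pi]
    exact Real.cos_lt_cos_of_nonneg_of_le_pi h0 le_rfl hπ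
  have h2 := Real.cos_le_one θ
  rw [abs_lt]
  constructor <;> linarith

/-- The set of admissible `l` in the definition of `capCharValue`. -/
def capCharSet (β : ℝ) : Set ℝ :=
  {l : ℝ | 0 < l ∧ ∃ Θ : ℝ → ℝ,
    ContinuousOn Θ (Set.Icc 0 β) ∧
    (∀ θ ∈ Set.Ioo (0 : ℝ) β, DifferentiableAt ℝ Θ θ) ∧
    (∀ θ ∈ Set.Ioo (0 : ℝ) β,
      deriv (fun t => Real.sin t * deriv Θ t) θ = -(l * (l + 1)) * Real.sin θ * Θ θ) ∧
    Θ β = 0 ∧ ∃ θ ∈ Set.Ioo (0 : ℝ) β, Θ θ ≠ 0}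

theorem mem_capCharSet_of_legendreFun_eq_zero {β l : ℝ} (hβ0 : 0 < β) (hβπ : β < π) (hl : 0 < l)
    (hl1 : l * (l + 1) ≤ 1) (hz : legendreFun (l * (l + 1)) ((1 - Real.cos β) / 2) = 0) :
    l ∈ capCharSet β := by
  set μ := l * (l + 1) with hμ
  have hμ0 : 0 ≤ μ := by positivity
  have hder : ∀ θ, 0 ≤ θ → θ < π →
      ∃ d, HasDerivAt (fun t => legendreFun μ ((1 - Real.cos t) / 2)) d θ ∧
        Real.sin θ * d = 2 * legendreFlux μ ((1 - Real.cos θ) / 2) := by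
    intro θ h0 hπ
    obtain ⟨d, hd, he⟩ :=
      exists_hasDerivAt_legendreFun hμ0 hl1 (abs_one_sub_cos_div_two_lt_one h0 hπ)
    have hcomp := hd.comp θ (hasDerivAt_one_sub_cos_div_two θ)
    refine ⟨_, hcomp, ?_⟩
    rw [← he]
    linear_combination (d / 2) * Real.sin_sq_add_cos_sq θ
  have hcont : ContinuousOn (fun t => legendreFun μ ((1 - Real.cos t) / 2)) (Set.Icc 0 β) := by
    intro θ hθ
    obtain ⟨d, hd, -⟩ := hder θ hθ.1 (hθ.2.trans_lt hβπ)
    exact hd.continuousAt.continuousWithinAt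
  refine ⟨hl, fun t => legendreFun μ ((1 - Real.cos t) / 2), hcont, ?_, ?_, hz, ?_⟩
  · intro θ hθ
    obtain ⟨d, hd, -⟩ := hder θ hθ.1.le (hθ.2.trans hβπ)
    exact hd.differentiableAt
  · intro θ hθ
    have hev : (fun t => Real.sin t * deriv (fun t => legendreFun μ ((1 - Real.cos t) / 2)) t)
        =ᶠ[𝓝 θ] fun t => 2 * legendreFlux μ ((1 - Real.cos t) / 2) := by
      filter_upwards [isOpen_Ioo.mem_nhds hθ] with t ht
      obtain ⟨d, hd, he⟩ := hder t ht.1.le (ht.2.trans hβπ)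
      rw [hd.deriv, he]
    rw [hev.deriv_eq]
    have h2 := ((hasDerivAt_legendreFlux hμ0 hl1
      (abs_one_sub_cos_div_two_lt_one hθ.1.le (hθ.2.trans hβπ))).comp θ
      (hasDerivAt_one_sub_cos_div_two θ)).const_mul 2
    refine h2.deriv.trans ?_
    ring
  · by_contra! hcon
    have h1 : Set.EqOn (fun t => legendreFun μ ((1 - Real.cos t) / 2)) (fun _ => 0)
        (Set.Icc 0 β) := by
      refine Set.EqOn.of_subset_closure (s := Set.Ioo 0 β) hcon hcont continuousOn_const
        Set.Ioo_subset_Icc_self ?_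
      rw [closure_Ioo hβ0.ne]
    have h2 := h1 ⟨le_rfl, hβ0.le⟩
    simp [legendreFun_zero_right] at h2

theorem sin_eq_half_angle (θ : ℝ) : Real.sin θ = 2 * Real.sin (θ / 2) * Real.cos (θ / 2) := by
  rw [← Real.sin_two_mul]; ring_nf

theorem cos_eq_half_angle (θ : ℝ) : Real.cos θ = 2 * Real.cos (θ / 2) ^ 2 - 1 := by
  rw [← Real.cos_two_mul]; ring_nf

theorem exists_mem_capCharSet {β : ℝ} (hβ0 : 0 < β) (hβπ : β < π)
    (hL : 4 ≤ -2 * Real.log (Real.cos (β / 2))) :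
    ∃ l ∈ capCharSet β, l ≤ 1 / (-2 * Real.log (Real.cos (β / 2)) - 2) := by
  set L := -2 * Real.log (Real.cos (β / 2)) with hLdef
  set x := (1 - Real.cos β) / 2 with hx
  have hx1 : |x| < 1 := abs_one_sub_cos_div_two_lt_one hβ0.le hβπ
  have hx0 : 0 ≤ x := by linarith [Real.cos_le_one β]
  have hlog : Real.log (1 - x) = -L := by
    have : 1 - x = Real.cos (β / 2) ^ 2 := by rw [hx, cos_eq_half_angle β]; ring
    rw [this, Real.log_pow, hLdef]
    push_cast
    ring
  have hle := fun μ h0 h1 => legendreFun_le (μ := μ) h0 h1 hx0 (abs_lt.1 hx1).2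
  simp only [hlog] at hle
  have hhalf : legendreFun (1 / 2) x ≤ 0 := by
    have := hle (1 / 2) (by norm_num) (by norm_num)
    linarith
  obtain ⟨μ, ⟨hμ0, hμ1⟩, hμz⟩ : (0 : ℝ) ∈ (fun μ => legendreFun μ x) '' Set.Icc 0 (1 / 2) := by
    refine intermediate_value_Icc' (by norm_num) ((continuousOn_legendreFun_param hx1).mono
      (Set.Icc_subset_Icc_right (by norm_num))) ⟨hhalf, ?_⟩
    simp [legendreFun_zero_left]
  simp only at hμz
  have hμpos : 0 < μ := by
    rcases hμ0.eq_or_lt with h | h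
    · rw [← h, legendreFun_zero_left] at hμz
      norm_num at hμz
    · exact h
  have hμL : μ * (1 - μ) * L ≤ 1 := by
    have := hle μ hμ0 (by linarith)
    rw [hμz] at this
    linarith
  have hμle : μ ≤ 1 / (L - 2) := by
    rw [le_div_iff₀ (by linarith)]
    have h2 : μ * L ≤ 2 := by
      nlinarith [mul_nonneg (mul_nonneg hμ0 (by linarith : (0 : ℝ) ≤ L))
        (by linarith : 0 ≤ 1 / 2 - μ)]
    nlinarith
  set l := (√(1 + 4 * μ) - 1) / 2 with hl
  have hsq : √(1 + 4 * μ) ^ 2 = 1 + 4 * μ := Real.sq_sqrt (by linarith)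
  have hl0 : 0 < l := by
    have : 1 < √(1 + 4 * μ) := by
      rw [Real.lt_sqrt (by norm_num)]; linarith
    linarith
  have hll : l * (l + 1) = μ := by
    rw [hl]; linear_combination hsq / 4
  refine ⟨l, mem_capCharSet_of_legendreFun_eq_zero hβ0 hβπ hl0 (by linarith) ?_, ?_⟩
  · rw [hll]; exact hμz
  · nlinarith

/-- Integrating a lower bound on the flux from a maximum point `m` to the next zero `b`. -/
theorem le_of_flux_ge {Θ : ℝ → ℝ} {m b c : ℝ} (hm : 0 ≤ m) (hmb : m < b) (hb : b < π)
    (hc : 0 ≤ c) (hcont : ContinuousOn Θ (Set.Icc m b))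
    (hdiff : ∀ θ ∈ Set.Ioo m b, DifferentiableAt ℝ Θ θ) (hΘb : Θ b = 0)
    (hflux : ∀ θ ∈ Set.Ioo m b, 0 ≤ Real.sin θ * deriv Θ θ + c * (1 - Real.cos θ)) :
    Θ m ≤ c * (-2 * Real.log (Real.cos (b / 2))) := by
  have hcos : ∀ θ ∈ Set.Icc m b, 0 < Real.cos (θ / 2) := fun θ hθ =>
    Real.cos_pos_of_mem_Ioo ⟨by linarith [hθ.1, Real.pi_pos], by linarith [hθ.2]⟩
  have hmono : MonotoneOn (fun θ => Θ θ - 2 * c * Real.log (Real.cos (θ / 2))) (Set.Icc m b) := by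
    refine monotoneOn_of_deriv_nonneg (convex_Icc m b) ?_ ?_ ?_
    · refine hcont.sub (continuousOn_const.mul (ContinuousOn.log (by fun_prop) ?_))
      exact fun θ hθ => (hcos θ hθ).ne'
    · rw [interior_Icc]
      intro θ hθ
      have h1 := hdiff θ hθ
      have h2 := (hcos θ (Set.Ioo_subset_Icc_self hθ)).ne'
      exact DifferentiableAt.differentiableWithinAt (by fun_prop (disch := assumption))
    · rw [interior_Icc]
      intro θ hθ
      have h1 := (hdiff θ hθ).hasDerivAt
      have h2 := hcos θ (Set.Ioo_subset_Icc_self hθ)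
      have h3 : HasDerivAt (fun t : ℝ => Real.cos (t / 2)) (-Real.sin (θ / 2) * (1 / 2)) θ :=
        ((hasDerivAt_id θ).div_const 2).cos
      have h4 := h1.sub ((h3.log h2.ne').const_mul (2 * c))
      have h5 : 0 < Real.sin (θ / 2) :=
        Real.sin_pos_of_pos_of_lt_pi (by linarith [hθ.1]) (by linarith [hθ.2, Real.pi_pos])
      have h6 := hflux θ hθ
      rw [sin_eq_half_angle θ, cos_eq_half_angle θ] at h6
      have h7 := Real.sin_sq_add_cos_sq (θ / 2)
      refine le_of_le_of_eq ?_ h4.deriv.symm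
      refine (mul_nonneg_iff_of_pos_left
        (c := 2 * Real.sin (θ / 2) * Real.cos (θ / 2)) (by positivity)).1 ?_
      refine h6.trans_eq ?_
      field_simp
      linear_combination (-2 * c) * h7
  have h := hmono ⟨le_rfl, hmb.le⟩ ⟨hmb.le, le_rfl⟩ hmb.le
  simp only [hΘb] at h
  have h8 : Real.log (Real.cos (m / 2)) ≤ 0 :=
    Real.log_nonpos (hcos m ⟨le_rfl, hmb.le⟩).le (Real.cos_le_one _)
  nlinarith [mul_nonneg hc (neg_nonneg.2 h8)]

/-- A function on `(0, θ₀]` whose flux is bounded above by a negative constant is unbounded. -/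
theorem exists_gt_of_flux_le {Θ : ℝ → ℝ} {θ₀ δ : ℝ} (h0 : 0 < θ₀) (hπ : θ₀ < π) (hδ : 0 < δ)
    (hdiff : ∀ θ ∈ Set.Ioc 0 θ₀, DifferentiableAt ℝ Θ θ)
    (hflux : ∀ θ ∈ Set.Ioc 0 θ₀, Real.sin θ * deriv Θ θ ≤ -δ) (M : ℝ) :
    ∃ θ ∈ Set.Ioc 0 θ₀, M < Θ θ := by
  have hanti : AntitoneOn (fun θ => Θ θ + δ * Real.log θ) (Set.Ioc 0 θ₀) := by
    refine antitoneOn_of_deriv_nonpos (convex_Ioc 0 θ₀) ?_ ?_ ?_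
    · intro θ hθ
      have h1 := (hdiff θ hθ).continuousAt
      have h2 := hθ.1.ne'
      exact ContinuousAt.continuousWithinAt (by fun_prop (disch := assumption))
    · rw [interior_Ioc]
      intro θ hθ
      have h1 := hdiff θ (Set.Ioo_subset_Ioc_self hθ)
      have h2 := hθ.1.ne'
      exact DifferentiableAt.differentiableWithinAt (by fun_prop (disch := assumption))
    · rw [interior_Ioc]
      intro θ hθ
      have h1 := (hdiff θ (Set.Ioo_subset_Ioc_self hθ)).hasDerivAt.add
        ((Real.hasDerivAt_log hθ.1.ne').const_mul δ)
      refine h1.deriv.trans_le ?_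
      have h2 := hflux θ (Set.Ioo_subset_Ioc_self hθ)
      have h3 : 0 < Real.sin θ := Real.sin_pos_of_pos_of_lt_pi hθ.1 (hθ.2.trans hπ)
      have h4 : Real.sin θ ≤ θ := Real.sin_le hθ.1.le
      have h5 : deriv Θ θ < 0 := by
        by_contra! h
        nlinarith [mul_nonneg h3.le h]
      have h6 : θ * deriv Θ θ ≤ -δ := by nlinarith
      refine nonpos_of_mul_nonpos_right (a := θ) ?_ hθ.1
      have h7 : θ * θ⁻¹ = 1 := mul_inv_cancel₀ hθ.1.ne'
      linear_combination h6 + δ * h7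
  have hlim : Tendsto (fun θ => Θ θ₀ + δ * Real.log θ₀ - δ * Real.log θ) (𝓝[>] 0) atTop := by
    have := (Real.tendsto_log_nhdsGT_zero.const_mul_atBot hδ)
    exact tendsto_atTop_add_const_left _ _ (tendsto_neg_atBot_atTop.comp this)
  obtain ⟨θ, hθM, hθ⟩ := ((hlim.eventually_gt_atTop M).and
    (Ioc_mem_nhdsGT h0)).exists
  refine ⟨θ, hθ, ?_⟩
  have := hanti hθ ⟨h0, le_rfl⟩ hθ.2
  simp only at this
  linarith

/-- If `Θ` attains its positive maximum over `[0, β]`, then the eigenvalue is bounded below. -/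
theorem one_le_eigenvalue_mul_log_of_max {Θ : ℝ → ℝ} {β μ m : ℝ} (hβπ : β < π) (hμ : 0 < μ)
    (hcont : ContinuousOn Θ (Set.Icc 0 β))
    (hdiff : ∀ θ ∈ Set.Ioo (0 : ℝ) β, DifferentiableAt ℝ Θ θ)
    (hode : ∀ θ ∈ Set.Ioo (0 : ℝ) β,
      deriv (fun t => Real.sin t * deriv Θ t) θ = -μ * Real.sin θ * Θ θ)
    (hβ : Θ β = 0) (hm : m ∈ Set.Icc 0 β) (hmax : ∀ θ ∈ Set.Icc 0 β, Θ θ ≤ Θ m)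
    (hpos : 0 < Θ m) : 1 ≤ μ * (-2 * Real.log (Real.cos (β / 2))) := by
  have hcontm : ContinuousOn Θ (Set.Icc m β) := hcont.mono (Set.Icc_subset_Icc_left hm.1)
  obtain ⟨b, ⟨⟨hmb', hbβ⟩, hΘb⟩, hleast⟩ :
      ∃ b, IsLeast {θ | θ ∈ Set.Icc m β ∧ Θ θ = 0} b := by
    refine IsCompact.exists_isLeast ?_ ⟨β, ⟨hm.2, le_rfl⟩, hβ⟩
    exact isCompact_Icc.of_isClosed_subset
      (hcontm.preimage_isClosed_of_isClosed isClosed_Icc isClosed_singleton) fun θ h => h.1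
  have hmb : m < b := by
    refine lt_of_le_of_ne hmb' ?_
    rintro rfl
    exact hpos.ne' hΘb
  have hΘpos : ∀ θ ∈ Set.Ico m b, 0 < Θ θ := by
    intro θ hθ
    by_contra! hneg
    have hθβ : θ ≤ β := hθ.2.le.trans hbβ
    obtain ⟨z, hz, hz0⟩ := intermediate_value_Icc' hθ.1
      (hcontm.mono (Set.Icc_subset_Icc_right hθβ)) ⟨hneg, hpos.le⟩
    have := hleast ⟨⟨hz.1, hz.2.trans hθβ⟩, hz0⟩
    linarith [hz.2, hθ.2]
  set g : ℝ → ℝ := fun θ => Real.sin θ * deriv Θ θ + μ * Θ m * (1 - Real.cos θ) with hg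
  have hgder : ∀ θ ∈ Set.Ico m b, 0 < θ →
      HasDerivAt g (μ * Real.sin θ * (Θ m - Θ θ)) θ := by
    intro θ hθ h0
    have hθβ : θ ∈ Set.Ioo 0 β := ⟨h0, hθ.2.trans_le hbβ⟩
    have hs : 0 < Real.sin θ := Real.sin_pos_of_pos_of_lt_pi h0 (hθβ.2.trans hβπ)
    have hne : deriv (fun t => Real.sin t * deriv Θ t) θ ≠ 0 := by
      rw [hode θ hθβ]
      have := mul_pos (mul_pos hμ hs) (hΘpos θ hθ)
      linarith
    have h1 := (differentiableAt_of_deriv_ne_zero hne).hasDerivAt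
    rw [hode θ hθβ] at h1
    have h2 := h1.add (((Real.hasDerivAt_cos θ).const_sub 1).const_mul (μ * Θ m))
    refine h2.congr_deriv ?_
    ring
  have hgmono : ∀ s ∈ Set.Ico m b, 0 < s → MonotoneOn g (Set.Ico s b) := by
    intro s hs hs0
    have hmem : ∀ θ ∈ Set.Ico s b, θ ∈ Set.Ico m b ∧ 0 < θ := fun θ hθ =>
      ⟨⟨hs.1.trans hθ.1, hθ.2⟩, hs0.trans_le hθ.1⟩
    refine monotoneOn_of_deriv_nonneg (convex_Ico s b) ?_ ?_ ?_
    · intro θ hθ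
      exact (hgder θ (hmem θ hθ).1 (hmem θ hθ).2).continuousAt.continuousWithinAt
    · intro θ hθ
      have hθ := interior_subset hθ
      exact (hgder θ (hmem θ hθ).1 (hmem θ hθ).2).differentiableAt.differentiableWithinAt
    · intro θ hθ
      have hθ := interior_subset hθ
      rw [(hgder θ (hmem θ hθ).1 (hmem θ hθ).2).deriv]
      have hθ0 := (hmem θ hθ).2
      have hθβ : θ < β := hθ.2.trans_le hbβ
      have h1 : 0 < Real.sin θ := Real.sin_pos_of_pos_of_lt_pi hθ0 (hθβ.trans hβπ)
      have h2 := hmax θ ⟨hθ0.le, hθβ.le⟩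
      exact mul_nonneg (by positivity) (by linarith)
  have hflux : ∀ θ ∈ Set.Ioo m b, 0 ≤ g θ := by
    intro θ hθ
    have hθ0 : 0 < θ := hm.1.trans_lt hθ.1
    rcases hm.1.eq_or_lt with h0 | h0
    · by_contra! hneg
      obtain ⟨t, ht, htM⟩ := exists_gt_of_flux_le (Θ := Θ) hθ0 (by linarith [hθ.2])
        (neg_pos.2 hneg)
        (fun t ht => hdiff t ⟨ht.1, by linarith [ht.2, hθ.2]⟩) (fun t ht => by
          have h1 := hgmono t ⟨by linarith [ht.1], by linarith [ht.2, hθ.2]⟩ ht.1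
            ⟨le_rfl, by linarith [ht.2, hθ.2]⟩ ⟨ht.2, hθ.2⟩ ht.2
          have h2 : 0 ≤ μ * Θ m * (1 - Real.cos t) :=
            mul_nonneg (by positivity) (by linarith [Real.cos_le_one t])
          have h3 : g t = Real.sin t * deriv Θ t + μ * Θ m * (1 - Real.cos t) := rfl
          linarith) (Θ m)
      have := hmax t ⟨ht.1.le, by linarith [ht.2, hθ.2]⟩
      linarith
    · have h1 := hgmono m ⟨le_rfl, hmb⟩ h0 ⟨le_rfl, hmb⟩ ⟨hθ.1.le, hθ.2⟩ hθ.1.le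
      have hloc : IsLocalMax Θ m := by
        filter_upwards [Icc_mem_nhds h0 (hmb.trans_le hbβ)] with t ht using hmax t ht
      have h2 : 0 ≤ g m := by
        simp only [hg, hloc.deriv_eq_zero, mul_zero, zero_add]
        exact mul_nonneg (by positivity) (by linarith [Real.cos_le_one m])
      linarith
  have hle := le_of_flux_ge hm.1 hmb (hbβ.trans_lt hβπ) (by positivity)
    (hcontm.mono (Set.Icc_subset_Icc_right hbβ))
    (fun θ hθ => hdiff θ ⟨hm.1.trans_lt hθ.1, hθ.2.trans_le hbβ⟩) hΘb hflux
  have hb0 : 0 < b := hm.1.trans_lt hmb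
  have hlog : Real.log (Real.cos (β / 2)) ≤ Real.log (Real.cos (b / 2)) := by
    refine Real.log_le_log (Real.cos_pos_of_mem_Ioo ⟨?_, ?_⟩)
      (Real.cos_le_cos_of_nonneg_of_le_pi ?_ ?_ ?_) <;> linarith
  have h9 : μ * Θ m * Real.log (Real.cos (β / 2)) ≤ μ * Θ m * Real.log (Real.cos (b / 2)) := by
    gcongr
  refine le_of_mul_le_mul_left ?_ hpos
  linarith

theorem one_le_of_mem_capCharSet {β l : ℝ} (hβπ : β < π) (hl : l ∈ capCharSet β) :
    1 ≤ l * (l + 1) * (-2 * Real.log (Real.cos (β / 2))) := by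
  obtain ⟨hl0, Θ, hcont, hdiff, hode, hβ, θ₀, hθ₀, hne⟩ := hl
  have hθ₀' := Set.Ioo_subset_Icc_self hθ₀
  have hμ : 0 < l * (l + 1) := by positivity
  obtain ⟨m, hm, hmax⟩ := isCompact_Icc.exists_isMaxOn ⟨θ₀, hθ₀'⟩ hcont.abs
  have hmax' : ∀ θ ∈ Set.Icc 0 β, |Θ θ| ≤ |Θ m| := fun θ hθ => hmax hθ
  have hpos : 0 < |Θ m| := (abs_pos.2 hne).trans_le (hmax' θ₀ hθ₀')
  rcases le_total 0 (Θ m) with h | h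
  · rw [abs_of_nonneg h] at hmax' hpos
    exact one_le_eigenvalue_mul_log_of_max hβπ hμ hcont hdiff hode hβ hm
      (fun θ hθ => (le_abs_self _).trans (hmax' θ hθ)) hpos
  · rw [abs_of_nonpos h] at hmax' hpos
    refine one_le_eigenvalue_mul_log_of_max (Θ := fun t => -Θ t) hβπ hμ hcont.neg
      (fun θ hθ => (hdiff θ hθ).neg) (fun θ hθ => ?_) (by simp [hβ]) hm
      (fun θ hθ => (neg_le_abs _).trans (hmax' θ hθ)) hpos
    have e : (fun t => Real.sin t * deriv (fun t => -Θ t) t)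
        = fun t => -(Real.sin t * deriv Θ t) := by
      funext t
      rw [deriv.fun_neg]
      ring
    rw [e, deriv.fun_neg, hode θ hθ]
    ring

theorem capCharValue_bounds {β : ℝ} (hβ0 : 0 < β) (hβπ : β < π)
    (hL : 4 ≤ -2 * Real.log (Real.cos (β / 2))) :
    1 / (-2 * Real.log (Real.cos (β / 2)) + 1) ≤ capCharValue β ∧
      capCharValue β ≤ 1 / (-2 * Real.log (Real.cos (β / 2)) - 2) := by
  obtain ⟨l₀, hl₀, hle⟩ := exists_mem_capCharSet hβ0 hβπ hL
  have hlow : ∀ l ∈ capCharSet β, 1 / (-2 * Real.log (Real.cos (β / 2)) + 1) ≤ l := by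
    intro l hl
    have h1 := one_le_of_mem_capCharSet hβπ hl
    have hl0 : 0 < l := hl.1
    set L := -2 * Real.log (Real.cos (β / 2))
    rw [div_le_iff₀ (by linarith)]
    by_contra! hcon
    have h2 : l * L < 1 := by linarith
    nlinarith
  exact ⟨le_csInf ⟨l₀, hl₀⟩ hlow, (csInf_le ⟨_, hlow⟩ hl₀).trans hle⟩

theorem two_mul_log_le_neg_two_mul_log_cos {β : ℝ} (hβ0 : 0 < β) (hβπ : β < π) :
    2 * Real.log (2 / (π - β)) ≤ -2 * Real.log (Real.cos (β / 2)) ∧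
      -2 * Real.log (Real.cos (β / 2)) ≤ 2 * Real.log (2 / (π - β)) + 2 := by
  set t := (π - β) / 2 with ht
  have ht0 : 0 < t := by linarith
  have hcos : Real.cos (β / 2) = Real.sin t := by
    rw [← Real.cos_pi_div_two_sub]
    congr 1
    rw [ht]
    ring
  have hinv : Real.log (2 / (π - β)) = -Real.log t := by
    rw [← Real.log_inv, ht, inv_div]
  have hsin := Real.mul_le_sin ht0.le (by linarith)
  have hπ := Real.pi_pos
  have hsinpos : 0 < Real.sin t := lt_of_lt_of_le (by positivity) hsin
  have h1 := Real.log_le_log hsinpos (Real.sin_le ht0.le)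
  have h2 := Real.log_le_log (by positivity) hsin
  rw [Real.log_mul (by positivity) ht0.ne', ← inv_div, Real.log_inv] at h2
  have h3 := Real.log_le_sub_one_of_pos (show 0 < π / 2 by positivity)
  have h4 := Real.pi_le_four
  rw [hcos, hinv]
  constructor <;> linarith

/-- for `N = 3`, `l_β ~ 1/(2 log(2/(π - β)))` as `β → π⁻`;
in particular `l_β → 0` and `(N + 2 l_β - 2)/N → 1/3` as `β → π⁻`. -/
theorem char_value_asymptotics_N3 :
    Tendsto (fun β => capCharValue β * (2 * Real.log (2 / (π - β))))
      (nhdsWithin π (Set.Iio π)) (nhds 1) ∧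
    Tendsto capCharValue (nhdsWithin π (Set.Iio π)) (nhds 0) ∧
    Tendsto (fun β => ((3 : ℝ) + 2 * capCharValue β - 2) / 3)
      (nhdsWithin π (Set.Iio π)) (nhds (1 / 3)) := by
  set K : ℝ → ℝ := fun β => 2 * Real.log (2 / (π - β)) with hK
  have hKlim : Tendsto K (𝓝[<] π) atTop := by
    have h1 : Tendsto (fun β : ℝ => π - β) (𝓝[<] π) (𝓝[>] 0) := by
      refine tendsto_nhdsWithin_iff.2 ⟨?_, ?_⟩
      · have : Tendsto (fun β : ℝ => π - β) (𝓝 π) (𝓝 (π - π)) :=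
          (continuous_const.sub continuous_id).tendsto π
        rw [sub_self] at this
        exact this.mono_left nhdsWithin_le_nhds
      · filter_upwards [self_mem_nhdsWithin] with β hβ using sub_pos.2 (Set.mem_Iio.1 hβ)
    have h2 : Tendsto (fun β : ℝ => 2 / (π - β)) (𝓝[<] π) atTop := by
      simp only [div_eq_mul_inv]
      exact (tendsto_inv_nhdsGT_zero.comp h1).const_mul_atTop two_pos
    exact (Real.tendsto_log_atTop.comp h2).const_mul_atTop two_pos
  have hev : ∀ᶠ β in 𝓝[<] π, 4 ≤ K β ∧ 1 / (K β + 3) ≤ capCharValue β ∧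
      capCharValue β ≤ 1 / (K β - 2) := by
    filter_upwards [hKlim.eventually_ge_atTop 4, Ioo_mem_nhdsLT Real.pi_pos] with β hβK hβ
    obtain ⟨h1, h2⟩ := two_mul_log_le_neg_two_mul_log_cos hβ.1 hβ.2
    obtain ⟨h3, h4⟩ := capCharValue_bounds hβ.1 hβ.2 (hβK.trans h1)
    simp only [hK] at hβK ⊢
    refine ⟨hβK, le_trans ?_ h3, h4.trans ?_⟩
    · exact one_div_le_one_div_of_le (by linarith) (by linarith)
    · exact one_div_le_one_div_of_le (by linarith) (by linarith)
  have hinv : ∀ c : ℝ, Tendsto (fun β => 1 / (K β + c)) (𝓝[<] π) (𝓝 0) := fun c => by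
    simp only [one_div]
    exact tendsto_inv_atTop_zero.comp (tendsto_atTop_add_const_right _ c hKlim)
  have hratio : ∀ c : ℝ, Tendsto (fun β => 1 / (K β + c) * K β) (𝓝[<] π) (𝓝 1) := fun c => by
    have h := ((hinv c).const_mul c).const_sub 1
    rw [mul_zero, sub_zero] at h
    refine h.congr' ?_
    filter_upwards [hKlim.eventually_gt_atTop (-c)] with β hβ
    have : K β + c ≠ 0 := by linarith
    field_simp
    ring
  have hzero : Tendsto capCharValue (𝓝[<] π) (𝓝 0) := by
    refine tendsto_of_tendsto_of_tendsto_of_le_of_le' (hinv 3) (hinv (-2)) ?_ ?_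
    · filter_upwards [hev] with β hβ using hβ.2.1
    · filter_upwards [hev] with β hβ using hβ.2.2
  refine ⟨?_, hzero, ?_⟩
  · refine tendsto_of_tendsto_of_tendsto_of_le_of_le' (hratio 3) (hratio (-2)) ?_ ?_
    · filter_upwards [hev] with β hβ
      exact mul_le_mul_of_nonneg_right hβ.2.1 (by linarith [hβ.1])
    · filter_upwards [hev] with β hβ
      exact mul_le_mul_of_nonneg_right hβ.2.2 (by linarith [hβ.1])
  · have h := (((hzero.const_mul 2).const_add 3).sub_const 2).div_const 3
    norm_num at h ⊢
    exact h
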